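/- arXiv:0910.2378 — 2 statements merged into one kernel-verified Lean document; each statement's English description precedes it below -/
import Mathlib

section
/- Let G and H be nontrivial finite groups. Then the free product G*H (with a word metric) is quasi-isometric to a simplicial tree, and consequently asdim_AN(G*H) = 1. -/
section Chains

variable {Y : Type*}

/-- An `r`-chain from `x` to `y` inside the set `S`, with respect to the distance
function `d`: a finite sequence `x = c 0, c 1, …, c m = y` of points of `S` with
consecutive distances `< r`. -/
def IsDChain (d : Y → Y → ℝ) (r : ℝ) (S : Set Y) (x y : Y) : Prop :=
  ∃ (m : ℕ) (c : ℕ → Y), c 0 = x ∧ c m = y ∧ (∀ i ≤ m, c i ∈ S) ∧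
    ∀ i < m, d (c i) (c (i + 1)) < r

/-- A set is `r`-scale connected if every two of its points are joined by an
`r`-chain contained in it. -/
def DScaleConnected (d : Y → Y → ℝ) (r : ℝ) (S : Set Y) : Prop :=
  ∀ x ∈ S, ∀ y ∈ S, IsDChain d r S x y

/-- `C` is an `r`-scale connected component of `U`: a maximal `r`-scale connected
subset of `U`. -/
def IsDComponent (d : Y → Y → ℝ) (r : ℝ) (U C : Set Y) : Prop :=
  C ⊆ U ∧ DScaleConnected d r C ∧
    ∀ C', C ⊆ C' → C' ⊆ U → DScaleConnected d r C' → C = C'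

/-- A set is `M`-bounded: its diameter is at most `M`. -/
def DBounded (d : Y → Y → ℝ) (M : ℝ) (S : Set Y) : Prop :=
  ∀ x ∈ S, ∀ y ∈ S, d x y ≤ M

/-- A space has dimension `≤ n` at scale `s` of magnitude `M` if there is a cover by
`n + 1` sets such that every `s`-scale connected component of each of them is
`M`-bounded. -/
def DimLeAtScale (d : Y → Y → ℝ) (n : ℕ) (s M : ℝ) : Prop :=
  ∃ U : Fin (n + 1) → Set Y, (∀ y, ∃ i, y ∈ U i) ∧
    ∀ i C, IsDComponent d s (U i) C → DBounded d M C

end Chains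
section WordMetric

variable {G : Type*} [Group G]

/-- The word length of `g` with respect to the generating set `S`: the least number of
factors from `S ∪ S⁻¹` needed to write `g`. -/
noncomputable def wordLength (S : Set G) (g : G) : ℕ :=
  sInf {m : ℕ | ∃ l : List G, l.length = m ∧ (∀ x ∈ l, x ∈ S ∨ x⁻¹ ∈ S) ∧ l.prod = g}

/-- The word metric on `G` associated with the generating set `S`. -/
noncomputable def wordDist (S : Set G) (g h : G) : ℝ :=
  (wordLength S (g⁻¹ * h) : ℝ)

end WordMetric

section ANdim

variable {Y : Type*}

/-- `f` is an `n`-dimensional control function: for every scale `s > 0` the space has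
dimension `≤ n` at scale `s` of magnitude `f s`. -/
def IsControlFunction (d : Y → Y → ℝ) (n : ℕ) (f : ℝ → ℝ) : Prop :=
  ∀ s : ℝ, 0 < s → DimLeAtScale d n s (f s)

/-- Asymptotic Assouad–Nagata dimension is at most `n`: there is a linear
`n`-dimensional control function. -/
def ANdimLe (d : Y → Y → ℝ) (n : ℕ) : Prop :=
  ∃ C b : ℝ, 0 < C ∧ 0 < b ∧ IsControlFunction d n (fun s => C * s + b)

/-- The asymptotic Assouad–Nagata dimension: the least `n` admitting a linear
`n`-dimensional control function (`⊤` if there is none). -/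
noncomputable def asdimAN (d : Y → Y → ℝ) : ℕ∞ :=
  sInf {N : ℕ∞ | ∃ n : ℕ, N = (n : ℕ∞) ∧ ANdimLe d n}

end ANdim
/-- A quasi-isometry between spaces with distance functions `dY` and `dZ`. -/
def IsQuasiIsometry {Y Z : Type*} (dY : Y → Y → ℝ) (dZ : Z → Z → ℝ) (f : Y → Z) : Prop :=
  ∃ lam C : ℝ, 1 ≤ lam ∧ 0 ≤ C ∧
    (∀ x x' : Y, dY x x' / lam - C ≤ dZ (f x) (f x') ∧ dZ (f x) (f x') ≤ lam * dY x x' + C) ∧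
    ∀ z : Z, ∃ x : Y, dZ (f x) z ≤ C

section WordMetricFacts

variable {N : Type*} [Group N] {A : Set N}

theorem wordLength_prod_le (l : List N) (hl : ∀ x ∈ l, x ∈ A ∨ x⁻¹ ∈ A) :
    wordLength A l.prod ≤ l.length :=
  Nat.sInf_le ⟨l, rfl, hl, rfl⟩

theorem wordLength_one : wordLength A 1 = 0 :=
  Nat.le_zero.mp (wordLength_prod_le [] (by simp))

theorem wordLength_le_one {s : N} (hs : s ∈ A ∨ s⁻¹ ∈ A) : wordLength A s ≤ 1 := by
  simpa using wordLength_prod_le [s] (by simpa using hs)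

/-- With respect to a generating set, the word length is attained by a list. -/
theorem exists_list_length_eq_wordLength (hA : Subgroup.closure A = ⊤) (g : N) :
    ∃ l : List N, l.length = wordLength A g ∧ (∀ x ∈ l, x ∈ A ∨ x⁻¹ ∈ A) ∧ l.prod = g := by
  have hg : g ∈ Submonoid.closure (A ∪ A⁻¹) := by
    rw [← Subgroup.closure_toSubmonoid, hA]
    trivial
  obtain ⟨l, hl, rfl⟩ := Submonoid.exists_list_of_mem_closure hg
  exact Nat.sInf_mem (s := {m : ℕ | ∃ l' : List N, l'.length = m ∧
    (∀ x ∈ l', x ∈ A ∨ x⁻¹ ∈ A) ∧ l'.prod = l.prod}) ⟨l.length, l, rfl, hl, rfl⟩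

theorem wordLength_mul_le (hA : Subgroup.closure A = ⊤) (g h : N) :
    wordLength A (g * h) ≤ wordLength A g + wordLength A h := by
  obtain ⟨l, hlen, hl, rfl⟩ := exists_list_length_eq_wordLength hA g
  obtain ⟨l', hlen', hl', rfl⟩ := exists_list_length_eq_wordLength hA h
  rw [← hlen, ← hlen', ← List.length_append, ← List.prod_append]
  refine wordLength_prod_le _ fun x hx => ?_
  rcases List.mem_append.mp hx with hx | hx
  exacts [hl x hx, hl' x hx]

theorem isDChain_univ_wordDist (hA : Subgroup.closure A = ⊤) {r : ℝ} (hr : 1 < r) (x y : N) :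
    IsDChain (wordDist A) r Set.univ x y := by
  obtain ⟨l, -, hl, hprod⟩ := exists_list_length_eq_wordLength hA (x⁻¹ * y)
  induction l generalizing x with
  | nil =>
    have hxy : x = y := inv_mul_eq_one.mp (by simpa using hprod.symm)
    exact ⟨0, fun _ => x, rfl, hxy, by simp, by simp⟩
  | cons s l ih =>
    obtain ⟨m, c, h0, hm, -, hc⟩ := ih (x * s) (fun z hz => hl z (List.mem_cons_of_mem _ hz))
      (by rw [mul_inv_rev, mul_assoc, ← hprod, List.prod_cons, inv_mul_cancel_left])
    refine ⟨m + 1, fun i => i.casesOn x c, rfl, hm, by simp, ?_⟩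
    rintro (_ | i) hi
    · have : (wordLength A s : ℝ) ≤ 1 := by exact_mod_cast wordLength_le_one (hl s (by simp))
      simpa [h0, wordDist] using this.trans_lt hr
    · exact hc i (by omega)

theorem not_ANdimLe_zero_wordDist (hA : Subgroup.closure A = ⊤)
    (hunb : ∀ n : ℕ, ∃ g h : N, n ≤ wordLength A (g⁻¹ * h)) :
    ¬ ANdimLe (wordDist A) 0 := by
  rintro ⟨C, b, -, -, hf⟩
  obtain ⟨U, hcov, hU⟩ := hf 2 two_pos
  have hU0 : U 0 = Set.univ := Set.eq_univ_of_forall fun y => by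
    obtain ⟨i, hi⟩ := hcov y
    rwa [Fin.fin_one_eq_zero i] at hi
  have hbd := hU 0 Set.univ ⟨hU0.ge,
    fun x _ y _ => isDChain_univ_wordDist hA one_lt_two x y,
    fun C' hC' _ _ => (Set.univ_subset_iff.mp hC').symm⟩
  obtain ⟨n, hn⟩ := exists_nat_gt (C * 2 + b)
  obtain ⟨g, h, hgh⟩ := hunb n
  have h1 : wordDist A g h ≤ C * 2 + b := hbd g trivial h trivial
  have h2 : (n : ℝ) ≤ wordDist A g h := Nat.cast_le.mpr hgh
  linarith

end WordMetricFacts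

theorem asdimAN_eq_one {Y : Type*} {d : Y → Y → ℝ} (h1 : ANdimLe d 1) (h0 : ¬ ANdimLe d 0) :
    asdimAN d = 1 := by
  refine le_antisymm (sInf_le ⟨1, rfl, h1⟩) (le_sInf ?_)
  rintro _ ⟨n, rfl, hn⟩
  rcases n.eq_zero_or_pos with rfl | hpos
  · exact absurd hn h0
  · exact_mod_cast hpos

/-- A rooted tree on the vertex set `V`, described by a depth function and a parent map;
the value of `parent` at the root is irrelevant. -/
structure ParentTree (V : Type*) where
  root : V
  parent : V → V
  depth : V → ℕ
  depth_root : depth root = 0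
  eq_root : ∀ v, depth v = 0 → v = root
  depth_parent : ∀ v, depth v ≠ 0 → depth v = depth (parent v) + 1

namespace ParentTree

variable {V : Type*} (P : ParentTree V)

/-- The graph joining each vertex other than the root to its parent. -/
def graph : SimpleGraph V where
  Adj u v := (P.depth u = P.depth v + 1 ∧ P.parent u = v) ∨
    (P.depth v = P.depth u + 1 ∧ P.parent v = u)
  symm := ⟨fun _ _ h => h.symm⟩
  loopless := ⟨fun _ h => by rcases h with h | h <;> omega⟩

/-- The ancestor of `v` at depth `m`. -/
def ancestor (m : ℕ) (v : V) : V := P.parent^[P.depth v - m] v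

theorem adj_parent {v : V} (hv : P.depth v ≠ 0) : P.graph.Adj v (P.parent v) :=
  Or.inl ⟨P.depth_parent v hv, rfl⟩

theorem ancestor_eq_ancestor_parent {m : ℕ} {v : V} (hv : P.depth v = P.depth (P.parent v) + 1)
    (hm : m ≤ P.depth (P.parent v)) : P.ancestor m v = P.ancestor m (P.parent v) := by
  rw [ancestor, ancestor, hv, Nat.succ_sub hm, Function.iterate_succ_apply]

theorem ancestor_eq_of_adj {m : ℕ} {u v : V} (h : P.graph.Adj u v) (hu : m ≤ P.depth u)
    (hv : m ≤ P.depth v) : P.ancestor m u = P.ancestor m v := by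
  rcases h with ⟨h, rfl⟩ | ⟨h, rfl⟩
  · exact P.ancestor_eq_ancestor_parent h hv
  · exact (P.ancestor_eq_ancestor_parent h hu).symm

theorem ancestor_self (v : V) : P.ancestor (P.depth v) v = v := by simp [ancestor]

theorem exists_walk_ancestor (m : ℕ) (v : V) :
    ∃ p : P.graph.Walk v (P.ancestor m v), p.length = P.depth v - m := by
  obtain ⟨k, hk⟩ : ∃ k, P.depth v - m = k := ⟨_, rfl⟩
  induction k generalizing v with
  | zero =>
    have : P.ancestor m v = v := by simp [ancestor, hk]
    exact ⟨SimpleGraph.Walk.nil.copy rfl this.symm, by simp [hk]⟩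
  | succ k ih =>
    have hv := P.depth_parent v (by omega)
    obtain ⟨p, hp⟩ := ih (P.parent v) (by omega)
    rw [P.ancestor_eq_ancestor_parent hv (by omega)]
    exact ⟨.cons (P.adj_parent (by omega)) p, by rw [SimpleGraph.Walk.length_cons]; omega⟩

theorem ancestor_zero (v : V) : P.ancestor 0 v = P.root := by
  refine P.eq_root _ ?_
  obtain ⟨k, hk⟩ : ∃ k, P.depth v = k := ⟨_, rfl⟩
  induction k generalizing v with
  | zero => simp [ancestor, hk]
  | succ k ih =>
    have hv := P.depth_parent v (by omega)
    rw [P.ancestor_eq_ancestor_parent hv (Nat.zero_le _)]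
    exact ih _ (by omega)

theorem connected : P.graph.Connected := by
  have h (v : V) : P.graph.Reachable v P.root := by
    obtain ⟨p, -⟩ := P.exists_walk_ancestor 0 v
    rw [P.ancestor_zero] at p
    exact ⟨p⟩
  have : Nonempty V := ⟨P.root⟩
  exact ⟨fun u v => (h u).trans (h v).symm⟩

theorem isBridge_parent {v : V} (hv : P.depth v = P.depth (P.parent v) + 1) :
    P.graph.IsBridge s(v, P.parent v) := by
  rw [SimpleGraph.isBridge_iff]
  rintro ⟨p⟩
  have key : ∀ {x y : V}, (P.graph.deleteEdges {s(v, P.parent v)}).Walk x y →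
      P.depth v ≤ P.depth x → P.ancestor (P.depth v) x = v → P.depth v ≤ P.depth y := by
    intro x y q
    induction q with
    | nil => exact fun h _ => h
    | @cons x z y h q ih =>
      intro hx hanc
      rw [SimpleGraph.deleteEdges_adj] at h
      obtain ⟨hadj, hne⟩ := h
      have hz : P.depth v ≤ P.depth z := by
        by_contra! hlt
        rcases hadj with ⟨hd, rfl⟩ | ⟨hd, -⟩
        · have hxv : P.depth v = P.depth x := by omega
          rw [hxv, P.ancestor_self] at hanc
          exact hne (by simp [hanc])
        · omega
      exact ih hz (P.ancestor_eq_of_adj hadj hx hz ▸ hanc)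
  have := key p le_rfl (P.ancestor_self v)
  omega

theorem isTree : P.graph.IsTree := by
  refine ⟨P.connected, SimpleGraph.isAcyclic_iff_forall_adj_isBridge.mpr fun u v h => ?_⟩
  rcases h with ⟨h, rfl⟩ | ⟨h, rfl⟩
  · exact P.isBridge_parent h
  · rw [Sym2.eq_swap]
    exact P.isBridge_parent h

theorem depth_le_of_walk {u v : V} (p : P.graph.Walk u v) : P.depth u ≤ P.depth v + p.length := by
  induction p with
  | nil => simp
  | cons h p ih =>
    rw [SimpleGraph.Walk.length_cons]
    rcases h with h | h <;> omega

theorem ancestor_eq_of_walk {m : ℕ} {u v : V} (p : P.graph.Walk u v)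
    (h : m + p.length ≤ P.depth u) : P.ancestor m u = P.ancestor m v := by
  induction p with
  | nil => rfl
  | cons hadj p ih =>
    rw [SimpleGraph.Walk.length_cons] at h
    have hd := hadj
    rw [ancestor_eq_of_adj P hadj (by omega) (by rcases hd with hd | hd <;> omega)]
    exact ih (by rcases hd with hd | hd <;> omega)

theorem depth_le_dist (u v : V) : P.depth u ≤ P.depth v + P.graph.dist u v := by
  obtain ⟨p, hp⟩ := P.connected.exists_walk_length_eq_dist u v
  exact hp ▸ P.depth_le_of_walk p

theorem ancestor_eq_of_dist {m : ℕ} {u v : V} (h : m + P.graph.dist u v ≤ P.depth u) :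
    P.ancestor m u = P.ancestor m v := by
  obtain ⟨p, hp⟩ := P.connected.exists_walk_length_eq_dist u v
  exact P.ancestor_eq_of_walk p (hp ▸ h)

theorem dist_ancestor_le (m : ℕ) (v : V) : P.graph.dist v (P.ancestor m v) ≤ P.depth v - m := by
  obtain ⟨p, hp⟩ := P.exists_walk_ancestor m v
  exact hp ▸ SimpleGraph.dist_le p

theorem dist_le_of_ancestor_eq {m n : ℕ} {u v : V} (h : P.ancestor m u = P.ancestor m v)
    (hu : P.depth u ≤ m + n) (hv : P.depth v ≤ m + n) : P.graph.dist u v ≤ 2 * n := by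
  have h1 := P.dist_ancestor_le m u
  have h2 := P.dist_ancestor_le m v
  have h3 := P.connected.dist_triangle (u := u) (v := P.ancestor m u) (w := v)
  rw [h, SimpleGraph.dist_comm (u := P.ancestor m v)] at h3
  rw [h] at h1
  omega

/-- Two close points lying in annuli of the same parity lie in the same annulus, and they
have the same ancestor one annulus below. -/
theorem annulus_eq_of_dist_lt {r : ℕ} {u v : V} (h : P.graph.dist u v < r)
    (hpar : P.depth u / r % 2 = P.depth v / r % 2) :
    P.depth u / r = P.depth v / r ∧
      P.ancestor (r * (P.depth u / r - 1)) u = P.ancestor (r * (P.depth u / r - 1)) v := by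
  have hr : 0 < r := by omega
  have h1 := P.depth_le_dist u v
  have h2 := P.depth_le_dist v u
  rw [SimpleGraph.dist_comm] at h2
  have h3 : P.depth u / r ≤ P.depth v / r + 1 := by
    rw [← Nat.add_div_right _ hr]; exact Nat.div_le_div_right (by omega)
  have h4 : P.depth v / r ≤ P.depth u / r + 1 := by
    rw [← Nat.add_div_right _ hr]; exact Nat.div_le_div_right (by omega)
  refine ⟨by omega, ?_⟩
  obtain hk | ⟨k, hk⟩ : P.depth u / r = 0 ∨ ∃ k, P.depth u / r = k + 1 :=
    (P.depth u / r).eq_zero_or_eq_succ_pred.imp_right fun h => ⟨_, h⟩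
  · simp [hk, ancestor_zero]
  · refine P.ancestor_eq_of_dist ?_
    have := Nat.mul_div_le (P.depth u) r
    rw [hk, mul_add] at this
    rw [hk, Nat.add_sub_cancel]
    omega

/-- Chains with steps shorter than `r` inside a union of annuli of width `r` and fixed parity
have endpoints at distance at most `4 * r`. -/
theorem dist_le_of_chain {r : ℕ} (hr : 0 < r) {j : ℕ} {n : ℕ} {c : ℕ → V}
    (hpar : ∀ i ≤ n, P.depth (c i) / r % 2 = j)
    (hc : ∀ i < n, P.graph.dist (c i) (c (i + 1)) < r) :
    P.graph.dist (c 0) (c n) ≤ 4 * r := by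
  have key : ∀ i ≤ n, P.depth (c 0) / r = P.depth (c i) / r ∧
      P.ancestor (r * (P.depth (c 0) / r - 1)) (c 0) =
        P.ancestor (r * (P.depth (c 0) / r - 1)) (c i) := by
    intro i hi
    induction i with
    | zero => exact ⟨rfl, rfl⟩
    | succ i ih =>
      obtain ⟨h1, h2⟩ := ih (by omega)
      obtain ⟨h3, h4⟩ := P.annulus_eq_of_dist_lt (hc i (by omega))
        ((hpar i (by omega)).trans (hpar (i + 1) hi).symm)
      rw [← h1] at h3 h4
      exact ⟨h3, h2.trans h4⟩
  obtain ⟨h1, h2⟩ := key n le_rfl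
  have hdepth (v : V) : P.depth v ≤ r * (P.depth v / r - 1) + 2 * r := by
    have := Nat.lt_mul_div_succ (P.depth v) hr
    have : r * (P.depth v / r + 1) ≤ r * (P.depth v / r - 1 + 2) :=
      Nat.mul_le_mul_left r (by omega)
    rw [mul_add r (P.depth v / r - 1)] at this
    omega
  have := P.dist_le_of_ancestor_eq h2 (hdepth _) (h1 ▸ hdepth _)
  omega

/-- A space mapping to a tree so that distances are distorted at most linearly has asymptotic
Assouad–Nagata dimension at most `1`. -/
theorem ANdimLe_one {Y : Type*} {d : Y → Y → ℝ} (F : Y → V) {K : ℕ}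
    (hK : 0 < K) (h2 : ∀ x y, (P.graph.dist (F x) (F y) : ℝ) ≤ 2 * d x y)
    (hd : ∀ x y, d x y ≤ K * P.graph.dist (F x) (F y)) : ANdimLe d 1 := by
  have hK' : (0 : ℝ) < K := by exact_mod_cast hK
  refine ⟨8 * K, 4 * K, by positivity, by positivity, fun s hs => ?_⟩
  set r := ⌈2 * s⌉₊ with hr
  have hr0 : 0 < r := Nat.ceil_pos.mpr (by positivity)
  refine ⟨fun i => {y | P.depth (F y) / r % 2 = i}, fun y => ?_, ?_⟩
  · exact ⟨⟨P.depth (F y) / r % 2, Nat.mod_lt _ two_pos⟩, rfl⟩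
  · rintro i C ⟨hCU, hC, -⟩ x hx y hy
    obtain ⟨n, c, rfl, rfl, hcC, hc⟩ := hC x hx y hy
    have hdist : P.graph.dist (F (c 0)) (F (c n)) ≤ 4 * r := by
      refine P.dist_le_of_chain hr0 (c := F ∘ c) (fun k hk => hCU (hcC k hk)) fun k hk => ?_
      have h : (P.graph.dist (F (c k)) (F (c (k + 1))) : ℝ) < r := by
        linarith [h2 (c k) (c (k + 1)), hc k hk, Nat.le_ceil (2 * s)]
      exact_mod_cast h
    have hdist' : (P.graph.dist (F (c 0)) (F (c n)) : ℝ) ≤ 4 * r := by exact_mod_cast hdist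
    have hrs : (r : ℝ) < 2 * s + 1 := Nat.ceil_lt_add_one (by positivity)
    calc d (c 0) (c n) ≤ K * P.graph.dist (F (c 0)) (F (c n)) := hd _ _
      _ ≤ K * (4 * (2 * s + 1)) := by gcongr; linarith
      _ = 8 * K * s + 4 * K := by ring

end ParentTree

section TreeAction

variable {N : Type*} [Group N] {A : Set N} {V : Type*} (P : ParentTree V)

theorem ParentTree.dist_le_two_mul_wordLength (hA : Subgroup.closure A = ⊤) {F : N → V}
    (hstep : ∀ g s, s ∈ A ∨ s⁻¹ ∈ A → P.graph.dist (F g) (F (g * s)) ≤ 2) (g h : N) :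
    P.graph.dist (F g) (F h) ≤ 2 * wordLength A (g⁻¹ * h) := by
  obtain ⟨l, hlen, hl, hprod⟩ := exists_list_length_eq_wordLength hA (g⁻¹ * h)
  rw [← hlen]
  obtain rfl : h = g * l.prod := by rw [hprod, mul_inv_cancel_left]
  clear hlen hprod
  induction l generalizing g with
  | nil => simp
  | cons s l ih =>
    have h1 := hstep g s (hl s (by simp))
    have h2 := ih (g * s) fun z hz => hl z (List.mem_cons_of_mem _ hz)
    have h3 := P.connected.dist_triangle (u := F g) (v := F (g * s)) (w := F (g * s * l.prod))
    rw [List.prod_cons, List.length_cons, ← mul_assoc]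
    omega

theorem ParentTree.wordLength_le_mul_dist (hA : Subgroup.closure A = ⊤) {F : N → V}
    (hF : Function.Surjective F) (hinj : Function.Injective F) {K : ℕ}
    (hadj : ∀ g h, P.graph.Adj (F g) (F h) → wordLength A (g⁻¹ * h) ≤ K) (g h : N) :
    wordLength A (g⁻¹ * h) ≤ K * P.graph.dist (F g) (F h) := by
  obtain ⟨p, hp⟩ := P.connected.exists_walk_length_eq_dist (F g) (F h)
  rw [← hp]
  clear hp
  generalize hu : F g = u at p
  generalize hv : F h = v at p
  induction p generalizing g with
  | nil =>
    obtain rfl := hinj (hu.trans hv.symm)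
    simp [wordLength_one]
  | @cons u w v huw p ih =>
    obtain ⟨k, rfl⟩ := hF w
    subst hu
    have h1 := hadj g k huw
    have h2 := ih k rfl hv
    have h3 := wordLength_mul_le hA (g⁻¹ * k) (k⁻¹ * h)
    rw [mul_assoc, mul_inv_cancel_left] at h3
    rw [SimpleGraph.Walk.length_cons, mul_add, mul_one]
    omega

end TreeAction

namespace Monoid.CoprodI.Word

variable {ι : Type*} {M : ι → Type*} [∀ i, Monoid (M i)]

/-- Reduced words form a tree, the parent of a nonempty word being obtained by removing its
first letter. -/
def parentTree : ParentTree (Word M) where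
  root := empty
  parent w := ⟨w.toList.tail, fun l hl => w.ne_one l (List.mem_of_mem_tail hl), w.chain_ne.tail⟩
  depth w := w.toList.length
  depth_root := rfl
  eq_root w hw := Word.ext (List.length_eq_zero_iff.mp hw)
  depth_parent w hw := by
    rw [List.length_tail]
    omega

theorem parentTree_adj_cons {i : ι} (m : M i) (w : Word M) (h : w.fstIdx ≠ some i) (hm : m ≠ 1) :
    parentTree.graph.Adj (cons m w h hm) w :=
  Or.inl ⟨rfl, rfl⟩

theorem exists_eq_cons_of_parent {u v : Word M} (hd : parentTree.depth u = parentTree.depth v + 1)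
    (hp : parentTree.parent u = v) : ∃ (i : ι) (m : M i) (h : v.fstIdx ≠ some i) (hm : m ≠ 1),
      u = cons m v h hm := by
  induction u using consRecOn with
  | empty => exact absurd hd (Nat.succ_ne_zero _).symm
  | cons i m w h1 h2 _ =>
    obtain rfl : w = v := hp
    exact ⟨i, m, h1, h2, rfl⟩

theorem exists_length_eq [Nontrivial ι] [∀ i, Nontrivial (M i)] (n : ℕ) :
    ∃ w : Word M, w.toList.length = n := by
  induction n with
  | zero => exact ⟨empty, rfl⟩
  | succ n ih =>
    obtain ⟨w, hw⟩ := ih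
    obtain ⟨i, hi⟩ : ∃ i, w.fstIdx ≠ some i := by
      cases w.fstIdx with
      | none => exact ⟨Classical.arbitrary ι, by simp⟩
      | some j => exact (exists_ne j).imp fun i hi => by simpa using hi.symm
    obtain ⟨m, hm⟩ := exists_ne (1 : M i)
    exact ⟨cons m w hi hm, by simp [hw]⟩

variable [∀ i, DecidableEq (M i)]

theorem dist_rcons_tail_le {i : ι} (p : Pair M i) :
    parentTree.graph.dist (rcons p) p.tail ≤ 1 := by
  by_cases h : p.head = 1
  · simp [rcons, h]
  · rw [rcons, dif_neg h]
    exact (SimpleGraph.dist_eq_one_iff_adj.mpr (parentTree_adj_cons _ _ _ _)).le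

variable [DecidableEq ι]

theorem exists_smul_of_adj {u v : Word M} (h : parentTree.graph.Adj u v) :
    ∃ (i : ι) (m : M i), u = m • v ∨ v = m • u := by
  rcases h with ⟨hd, hp⟩ | ⟨hd, hp⟩ <;> obtain ⟨i, m, h, hm, e⟩ := exists_eq_cons_of_parent hd hp
  · exact ⟨i, m, .inl (e.trans cons_eq_smul)⟩
  · exact ⟨i, m, .inr (e.trans cons_eq_smul)⟩

theorem dist_smul_le {i : ι} (m : M i) (w : Word M) :
    parentTree.graph.dist w (m • w) ≤ 2 := by
  have h1 := dist_rcons_tail_le (equivPair i w)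
  have h2 : parentTree.graph.dist (m • w) (equivPair i w).tail ≤ 1 := by
    rw [smul_def]
    exact dist_rcons_tail_le _
  have h3 : rcons (equivPair i w) = w := by rw [← equivPair_symm, Equiv.symm_apply_apply]
  rw [h3] at h1
  rw [SimpleGraph.dist_comm] at h2
  have := parentTree.connected.dist_triangle (u := w) (v := (equivPair i w).tail) (w := m • w)
  omega

end Monoid.CoprodI.Word

namespace Monoid.Coprod

universe u v

variable {G : Type u} {H : Type v} [Group G] [Group H]

theorem closure_image_inl_union_image_inr {S : Set G} {T : Set H}
    (hS : Subgroup.closure S = ⊤) (hT : Subgroup.closure T = ⊤) :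
    Subgroup.closure ((inl : G →* Monoid.Coprod G H) '' S ∪
      (inr : H →* Monoid.Coprod G H) '' T) = ⊤ := by
  rw [Subgroup.closure_union, ← MonoidHom.map_closure, ← MonoidHom.map_closure, hS, hT,
    ← MonoidHom.range_eq_map, ← MonoidHom.range_eq_map, range_inl_sup_range_inr]

variable (G H) [Finite G] [Finite H]

/-- The two factors of a free product of finite groups, as a family of types in the lowest
universe. -/
abbrev ShrunkFactor (b : Bool) : Type := bif b then Shrink.{0} G else Shrink.{0} H

noncomputable instance shrunkFactorGroup : ∀ b, Group (ShrunkFactor G H b)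
  | true => inferInstanceAs (Group (Shrink.{0} G))
  | false => inferInstanceAs (Group (Shrink.{0} H))

/-- The inclusion of a factor into the free product. -/
noncomputable def ofShrunkFactor : ∀ b, ShrunkFactor G H b →* Monoid.Coprod G H
  | true => inl.comp (Shrink.mulEquiv : Shrink.{0} G ≃* G).toMonoidHom
  | false => inr.comp (Shrink.mulEquiv : Shrink.{0} H ≃* H).toMonoidHom

/-- The binary free product as an indexed free product. -/
noncomputable def mulEquivCoprodI :
    Monoid.Coprod G H ≃* Monoid.CoprodI (ShrunkFactor G H) :=
  MonoidHom.toMulEquiv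
    (lift ((CoprodI.of (M := ShrunkFactor G H) (i := true)).comp
        (Shrink.mulEquiv : Shrink.{0} G ≃* G).symm.toMonoidHom)
      ((CoprodI.of (M := ShrunkFactor G H) (i := false)).comp
        (Shrink.mulEquiv : Shrink.{0} H ≃* H).symm.toMonoidHom))
    (CoprodI.lift (ofShrunkFactor G H))
    (by
      ext x
      · simp [ofShrunkFactor]
      · simp [ofShrunkFactor])
    (by
      ext b x
      cases b <;> simp [ofShrunkFactor])

variable {G H}

theorem exists_mulEquivCoprodI_eq_of {S : Set G} {T : Set H} {x : Monoid.Coprod G H}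
    (hx : x ∈ (inl : G →* Monoid.Coprod G H) '' S ∪ (inr : H →* Monoid.Coprod G H) '' T) :
    ∃ (b : Bool) (m : ShrunkFactor G H b), mulEquivCoprodI G H x = CoprodI.of m := by
  rcases hx with ⟨a, -, rfl⟩ | ⟨a, -, rfl⟩
  · exact ⟨true, (Shrink.mulEquiv : Shrink.{0} G ≃* G).symm a, rfl⟩
  · exact ⟨false, (Shrink.mulEquiv : Shrink.{0} H ≃* H).symm a, rfl⟩

theorem mulEquivCoprodI_ofShrunkFactor (b : Bool) (m : ShrunkFactor G H b) :
    mulEquivCoprodI G H (ofShrunkFactor G H b m) = CoprodI.of m := by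
  rw [← MulEquiv.eq_symm_apply]
  exact (CoprodI.lift_of (ofShrunkFactor G H) m).symm

open Classical in
/-- The reduced word of the inverse of an element of the free product, so that right
multiplication by a letter acts at the beginning of the word. -/
noncomputable def invWord : Monoid.Coprod G H ≃ CoprodI.Word (ShrunkFactor G H) :=
  ((Equiv.inv _).trans (mulEquivCoprodI G H).toEquiv).trans CoprodI.Word.equiv

open Classical in
theorem invWord_mul (g s : Monoid.Coprod G H) :
    invWord (g * s) = mulEquivCoprodI G H s⁻¹ • invWord g := by
  change mulEquivCoprodI G H (g * s)⁻¹ • (CoprodI.Word.empty : CoprodI.Word (ShrunkFactor G H)) =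
    mulEquivCoprodI G H s⁻¹ • mulEquivCoprodI G H g⁻¹ • CoprodI.Word.empty
  rw [mul_inv_rev, map_mul, mul_smul]

open Classical in
theorem dist_invWord_mul_le {S : Set G} {T : Set H} (g s : Monoid.Coprod G H)
    (hs : s ∈ (inl : G →* Monoid.Coprod G H) '' S ∪ (inr : H →* Monoid.Coprod G H) '' T ∨
      s⁻¹ ∈ (inl : G →* Monoid.Coprod G H) '' S ∪ (inr : H →* Monoid.Coprod G H) '' T) :
    CoprodI.Word.parentTree.graph.dist (invWord g) (invWord (g * s)) ≤ 2 := by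
  obtain ⟨b, m, hm⟩ : ∃ (b : Bool) (m : ShrunkFactor G H b),
      mulEquivCoprodI G H s⁻¹ = CoprodI.of m := by
    rcases hs with hs | hs
    · obtain ⟨b, m, hm⟩ := exists_mulEquivCoprodI_eq_of hs
      exact ⟨b, m⁻¹, by rw [map_inv, hm, map_inv]⟩
    · exact exists_mulEquivCoprodI_eq_of hs
  rw [invWord_mul, hm]
  exact CoprodI.Word.dist_smul_le m _

open Classical in
theorem exists_inv_mul_eq_ofShrunkFactor {g h : Monoid.Coprod G H}
    (hadj : CoprodI.Word.parentTree.graph.Adj (invWord g) (invWord h)) :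
    ∃ (b : Bool) (m : ShrunkFactor G H b), g⁻¹ * h = ofShrunkFactor G H b m := by
  have key (b : Bool) (m : ShrunkFactor G H b) (x y : Monoid.Coprod G H)
      (hxy : invWord x = m • invWord y) : x⁻¹ * y = ofShrunkFactor G H b m := by
    have hx : invWord x = invWord (y * (ofShrunkFactor G H b m)⁻¹) := by
      rw [invWord_mul, inv_inv, mulEquivCoprodI_ofShrunkFactor, hxy, CoprodI.Word.smul_eq_of_smul]
    rw [invWord.injective hx]
    group
  obtain ⟨b, m, h | h⟩ := CoprodI.Word.exists_smul_of_adj hadj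
  · exact ⟨b, m, key b m _ _ h⟩
  · refine ⟨b, m⁻¹, ?_⟩
    rw [map_inv, ← key b m _ _ h]
    group

theorem exists_wordLength_ofShrunkFactor_le (A : Set (Monoid.Coprod G H)) :
    ∃ K : ℕ, 0 < K ∧ ∀ b m, wordLength A (ofShrunkFactor G H b m) ≤ K := by
  have (b : Bool) : Finite (ShrunkFactor G H b) := by
    cases b
    · exact inferInstanceAs (Finite (Shrink.{0} H))
    · exact inferInstanceAs (Finite (Shrink.{0} G))
  obtain ⟨K, hK⟩ := (Set.finite_range fun p : Σ b, ShrunkFactor G H b =>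
    wordLength A (ofShrunkFactor G H p.1 p.2)).bddAbove
  exact ⟨K + 1, K.succ_pos, fun b m => (hK ⟨⟨b, m⟩, rfl⟩).trans K.le_succ⟩

end Monoid.Coprod

/-- If `G` and `H` are nontrivial finite groups, then the free product `G ∗ H` (with a
word metric) is quasi-isometric to a simplicial tree, and consequently
`asdim_AN (G ∗ H) = 1`. -/
theorem freeProduct_of_finite_qi_tree (G H : Type*) [Group G] [Group H]
    [Finite G] [Finite H] [Nontrivial G] [Nontrivial H]
    (S : Set G) (T : Set H) (hSfin : S.Finite) (hTfin : T.Finite)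
    (hSgen : Subgroup.closure S = ⊤) (hTgen : Subgroup.closure T = ⊤) :
    (∃ (V : Type) (Γ : SimpleGraph V), Γ.IsTree ∧
      ∃ f : Monoid.Coprod G H → V,
        IsQuasiIsometry
          (wordDist ((⇑(Monoid.Coprod.inl : G →* Monoid.Coprod G H) '' S) ∪
            (⇑(Monoid.Coprod.inr : H →* Monoid.Coprod G H) '' T)))
          (fun u v => (Γ.dist u v : ℝ)) f) ∧
    asdimAN (wordDist ((⇑(Monoid.Coprod.inl : G →* Monoid.Coprod G H) '' S) ∪
        (⇑(Monoid.Coprod.inr : H →* Monoid.Coprod G H) '' T))) = 1 := by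
  classical
  have hA := Monoid.Coprod.closure_image_inl_union_image_inr hSgen hTgen
  set A := (⇑(Monoid.Coprod.inl : G →* Monoid.Coprod G H) '' S) ∪
    (⇑(Monoid.Coprod.inr : H →* Monoid.Coprod G H) '' T)
  let P : ParentTree (Monoid.CoprodI.Word (Monoid.Coprod.ShrunkFactor G H)) :=
    Monoid.CoprodI.Word.parentTree
  let F : Monoid.Coprod G H ≃ Monoid.CoprodI.Word (Monoid.Coprod.ShrunkFactor G H) :=
    Monoid.Coprod.invWord
  obtain ⟨K, hK, hKA⟩ := Monoid.Coprod.exists_wordLength_ofShrunkFactor_le A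
  have h2 (g h) : P.graph.dist (F g) (F h) ≤ 2 * wordLength A (g⁻¹ * h) :=
    P.dist_le_two_mul_wordLength hA (fun g s hs => Monoid.Coprod.dist_invWord_mul_le g s hs) g h
  have hd (g h) : wordLength A (g⁻¹ * h) ≤ K * P.graph.dist (F g) (F h) := by
    refine P.wordLength_le_mul_dist hA F.surjective F.injective (fun g h hadj => ?_) g h
    obtain ⟨b, m, hm⟩ := Monoid.Coprod.exists_inv_mul_eq_ofShrunkFactor hadj
    exact hm ▸ hKA b m
  have h2' (g h) : (P.graph.dist (F g) (F h) : ℝ) ≤ 2 * wordDist A g h := by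
    rw [wordDist]
    exact_mod_cast h2 g h
  have hd' (g h) : wordDist A g h ≤ K * P.graph.dist (F g) (F h) := by
    rw [wordDist]
    exact_mod_cast hd g h
  refine ⟨⟨_, P.graph, P.isTree, F, K + 2, 0, by linarith [K.cast_nonneg (α := ℝ)], le_rfl,
    fun g h => ⟨?_, ?_⟩, fun z => ⟨F.symm z, by simp⟩⟩,
    asdimAN_eq_one (P.ANdimLe_one F hK h2' hd') (not_ANdimLe_zero_wordDist hA fun n => ?_)⟩
  · rw [sub_zero, div_le_iff₀ (by positivity)]
    linarith [hd' g h, (P.graph.dist (F g) (F h)).cast_nonneg (α := ℝ)]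
  · have : 0 ≤ K * wordDist A g h := mul_nonneg K.cast_nonneg (Nat.cast_nonneg _)
    linarith [h2' g h]
  · have (b : Bool) : Nontrivial (Monoid.Coprod.ShrunkFactor G H b) := by
      cases b
      · exact inferInstanceAs (Nontrivial (Shrink.{0} H))
      · exact inferInstanceAs (Nontrivial (Shrink.{0} G))
    obtain ⟨w, hw⟩ := Monoid.CoprodI.Word.exists_length_eq
      (M := Monoid.Coprod.ShrunkFactor G H) (2 * n)
    refine ⟨F.symm w, F.symm P.root, ?_⟩
    have h3 := h2 (F.symm w) (F.symm P.root)
    rw [F.apply_symm_apply, F.apply_symm_apply] at h3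
    have h4 := P.depth_le_dist w P.root
    have h5 : P.depth w = 2 * n := hw
    rw [P.depth_root] at h4
    omega
end

section
/- Let X be a tree-graded space and P a piece of X. For every point x ∈ X there exists a unique point y ∈ P such that d(x, P) = d(x, y). Moreover, every geodesic joining x with a point of P contains y. -/
open Set Metric

section Core

variable {X : Type*} [MetricSpace X]

/-- A geodesic segment parametrized by the interval `[a, b]`:
an isometric embedding of `[a, b]` into `X`. -/
def IsGeodesicSegment (γ : ℝ → X) (a b : ℝ) : Prop :=
  ∀ s ∈ Set.Icc a b, ∀ t ∈ Set.Icc a b, dist (γ s) (γ t) = |s - t|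

/-- A metric space is geodesic if every two points are joined by a geodesic. -/
def GeodesicSpace (X : Type*) [MetricSpace X] : Prop :=
  ∀ x y : X, ∃ γ : ℝ → X, IsGeodesicSegment γ 0 (dist x y) ∧ γ 0 = x ∧ γ (dist x y) = y

/-- A subset is geodesic if every two of its points are joined by a geodesic of `X`
contained in the subset. -/
def IsGeodesicSubset (S : Set X) : Prop :=
  ∀ x ∈ S, ∀ y ∈ S, ∃ γ : ℝ → X, IsGeodesicSegment γ 0 (dist x y) ∧ γ 0 = x ∧
    γ (dist x y) = y ∧ ∀ t ∈ Set.Icc (0 : ℝ) (dist x y), γ t ∈ S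

/-- A (complete geodesic) metric space is tree-graded with respect to a collection `PX`
of closed geodesic subsets (pieces) covering `X` if every two different pieces meet in
at most one point (T₁) and every simple loop (injective continuous image of a circle)
is contained in one piece (T₂''). -/
structure IsTreeGraded (X : Type*) [MetricSpace X] (PX : Set (Set X)) : Prop where
  nonempty : ∀ P ∈ PX, P.Nonempty
  closed : ∀ P ∈ PX, IsClosed P
  geodesicSub : ∀ P ∈ PX, IsGeodesicSubset P
  covers : ∀ x : X, ∃ P ∈ PX, x ∈ P
  t1 : ∀ P ∈ PX, ∀ Q ∈ PX, P ≠ Q → (P ∩ Q).Subsingleton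
  t2 : ∀ loop : AddCircle (1 : ℝ) → X, Continuous loop → Function.Injective loop →
    ∃ P ∈ PX, Set.range loop ⊆ P

end Core

section TreeGraded

variable {X : Type*} [MetricSpace X]

lemma IsGeodesicSegment.continuousOn {γ : ℝ → X} {a b : ℝ} (h : IsGeodesicSegment γ a b) :
    ContinuousOn γ (Set.Icc a b) := by
  have hl : LipschitzOnWith 1 γ (Set.Icc a b) :=
    LipschitzOnWith.of_dist_le_mul fun s hs t ht => by
      rw [h s hs t ht, Real.dist_eq, NNReal.coe_one, one_mul]
  exact hl.continuousOn

lemma IsGeodesicSegment.injOn {γ : ℝ → X} {a b : ℝ} (h : IsGeodesicSegment γ a b) :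
    Set.InjOn γ (Set.Icc a b) := by
  intro s hs t ht hst
  have h1 := h s hs t ht
  rw [hst, dist_self] at h1
  exact sub_eq_zero.mp (abs_eq_zero.mp h1.symm)

lemma IsGeodesicSegment.mono {γ : ℝ → X} {a b a' b' : ℝ} (h : IsGeodesicSegment γ a b)
    (ha : a ≤ a') (hb : b' ≤ b) : IsGeodesicSegment γ a' b' :=
  fun s hs t ht => h s (Set.Icc_subset_Icc ha hb hs) t (Set.Icc_subset_Icc ha hb ht)

lemma IsGeodesicSegment.dist_zero_left {γ : ℝ → X} {L t : ℝ} (h : IsGeodesicSegment γ 0 L)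
    (ht : t ∈ Set.Icc 0 L) : dist (γ 0) (γ t) = t := by
  rw [h 0 ⟨le_rfl, ht.1.trans ht.2⟩ t ht, zero_sub, abs_neg, abs_of_nonneg ht.1]

lemma IsGeodesicSegment.exists_first_mem {γ : ℝ → X} {L : ℝ} {P : Set X} (hL : 0 ≤ L)
    (h : IsGeodesicSegment γ 0 L) (hP : IsClosed P) (hγ : γ L ∈ P) :
    ∃ t ∈ Set.Icc 0 L, γ t ∈ P ∧ ∀ u ∈ Set.Ico 0 t, γ u ∉ P := by
  have hc : IsCompact (Set.Icc 0 L ∩ γ ⁻¹' P) :=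
    isCompact_Icc.of_isClosed_subset
      (h.continuousOn.preimage_isClosed_of_isClosed isClosed_Icc hP) Set.inter_subset_left
  obtain ⟨t, ht, hmin⟩ := hc.exists_isLeast ⟨L, ⟨hL, le_rfl⟩, hγ⟩
  exact ⟨t, ht.1, ht.2, fun u hu huP =>
    hu.2.not_ge (hmin ⟨⟨hu.1, hu.2.le.trans ht.1.2⟩, huP⟩)⟩

lemma continuousOn_ite_le_Icc {Y : Type*} [TopologicalSpace Y] {f g : ℝ → Y} {a b c : ℝ}
    (hab : a ≤ b) (hbc : b ≤ c) (hf : ContinuousOn f (Set.Icc a b))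
    (hg : ContinuousOn g (Set.Icc b c)) (hfg : f b = g b) :
    ContinuousOn (fun t => if t ≤ b then f t else g t) (Set.Icc a c) := by
  rw [← Set.Icc_union_Icc_eq_Icc hab hbc]
  refine ContinuousOn.union_of_isClosed (hf.congr fun t ht => if_pos ht.2)
    (hg.congr fun t ht => ?_) isClosed_Icc isClosed_Icc
  rcases ht.1.eq_or_lt with rfl | hlt
  · simp [hfg]
  · exact if_neg hlt.not_ge

variable {PX : Set (Set X)}

lemma IsTreeGraded.exists_piece_of_loop (h : IsTreeGraded X PX) {f : ℝ → X} {a b : ℝ}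
    (hab : a < b) (hc : ContinuousOn f (Set.Icc a b)) (hinj : Set.InjOn f (Set.Ico a b))
    (hends : f a = f b) : ∃ Q ∈ PX, ∀ t ∈ Set.Ico a b, f t ∈ Q := by
  have hba : 0 < b - a := sub_pos.2 hab
  let g : ℝ → X := fun u => f (a + u * (b - a))
  have hg : ContinuousOn g (Set.Icc 0 (0 + 1)) := by
    refine hc.comp (by fun_prop) fun u hu => ?_
    have h1 := hu.1
    have h2 := hu.2
    constructor <;> nlinarith
  have hmaps : ∀ u ∈ Set.Ico (0 : ℝ) (0 + 1), a + u * (b - a) ∈ Set.Ico a b := by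
    intro u hu
    have h1 := hu.1
    have h2 := hu.2
    constructor <;> nlinarith
  have hg01 : g 0 = g (0 + 1) := by simp [g, hends]
  have : Fact ((0 : ℝ) < 1) := ⟨one_pos⟩
  have hloop_inj : Function.Injective (AddCircle.liftIco (1 : ℝ) 0 g) := by
    intro x y hxy
    obtain ⟨u, hu, rfl⟩ := AddCircle.coe_image_Ico_eq (1 : ℝ) 0 ▸ Set.mem_univ x
    obtain ⟨v, hv, rfl⟩ := AddCircle.coe_image_Ico_eq (1 : ℝ) 0 ▸ Set.mem_univ y
    rw [AddCircle.liftIco_coe_apply hu, AddCircle.liftIco_coe_apply hv] at hxy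
    have huv := hinj (hmaps u hu) (hmaps v hv) hxy
    rw [mul_right_cancel₀ hba.ne' (add_left_cancel huv)]
  obtain ⟨Q, hQ, hsub⟩ := h.t2 _ (AddCircle.liftIco_continuous hg01 hg) hloop_inj
  refine ⟨Q, hQ, fun t ht => ?_⟩
  have hu : (t - a) / (b - a) ∈ Set.Ico (0 : ℝ) (0 + 1) :=
    ⟨div_nonneg (sub_nonneg.2 ht.1) hba.le, by
      rw [zero_add, div_lt_one hba]; linarith [ht.2]⟩
  have hmem := hsub ⟨(((t - a) / (b - a) : ℝ) : AddCircle (1 : ℝ)), rfl⟩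
  rw [AddCircle.liftIco_coe_apply hu] at hmem
  simpa [g, div_mul_cancel₀ _ hba.ne'] using hmem

/-- A nondegenerate simple arc with both endpoints in a piece meets that piece in an interior
point. -/
lemma IsTreeGraded.exists_mem_Ioo_of_arc (h : IsTreeGraded X PX) {P : Set X} (hP : P ∈ PX)
    {α : ℝ → X} {a b : ℝ} (hab : a < b) (hc : ContinuousOn α (Set.Icc a b))
    (hinj : Set.InjOn α (Set.Icc a b)) (ha : α a ∈ P) (hb : α b ∈ P) :
    ∃ t ∈ Set.Ioo a b, α t ∈ P := by
  by_contra! hout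
  have hne : α b ≠ α a := fun he =>
    hab.ne' (hinj (Set.right_mem_Icc.2 hab.le) (Set.left_mem_Icc.2 hab.le) he)
  obtain ⟨β, hβ, hβ0, hβD, hβP⟩ := h.geodesicSub P hP _ hb _ ha
  have hD : 0 < dist (α b) (α a) := dist_pos.2 hne
  set D := dist (α b) (α a)
  let f : ℝ → X := fun t => if t ≤ b then α t else β (t - b)
  have hfc : ContinuousOn f (Set.Icc a (b + D)) := by
    refine continuousOn_ite_le_Icc hab.le (by linarith) hc ?_ (by simp [hβ0])
    exact hβ.continuousOn.comp (by fun_prop) fun t ht =>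
      ⟨by linarith [ht.1], by linarith [ht.2]⟩
  have hfα : ∀ t, t ≤ b → f t = α t := fun t ht => if_pos ht
  have hfβ : ∀ t, b < t → f t = β (t - b) := fun t ht => if_neg ht.not_ge
  have hmixed : ∀ t ∈ Set.Ico a (b + D), ∀ u ∈ Set.Ico a (b + D), t ≤ b → b < u →
      f t ≠ f u := by
    intro t ht u hu htb hbu heq
    rw [hfα t htb, hfβ u hbu] at heq
    have hu' : u - b ∈ Set.Icc 0 D := ⟨by linarith, by linarith [hu.2]⟩
    rcases ht.1.eq_or_lt with rfl | hat
    · rw [← hβD] at heq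
      have := hβ.injOn ⟨hD.le, le_rfl⟩ hu' heq
      linarith [hu.2]
    · rcases htb.eq_or_lt with rfl | htb
      · rw [← hβ0] at heq
        have := hβ.injOn ⟨le_rfl, hD.le⟩ hu' heq
        linarith
      · exact hout t ⟨hat, htb⟩ (heq ▸ hβP _ hu')
  have hfinj : Set.InjOn f (Set.Ico a (b + D)) := by
    intro t ht u hu heq
    rcases le_or_gt t b with htb | htb <;> rcases le_or_gt u b with hub | hub
    · rw [hfα t htb, hfα u hub] at heq
      exact hinj ⟨ht.1, htb⟩ ⟨hu.1, hub⟩ heq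
    · exact absurd heq (hmixed t ht u hu htb hub)
    · exact absurd heq.symm (hmixed u hu t ht hub htb)
    · rw [hfβ t htb, hfβ u hub] at heq
      have := hβ.injOn ⟨by linarith, by linarith [ht.2]⟩ ⟨by linarith, by linarith [hu.2]⟩ heq
      linarith
  have hends : f a = f (b + D) := by
    rw [hfα a hab.le, hfβ _ (by linarith), add_sub_cancel_left, hβD]
  obtain ⟨Q, hQ, hfQ⟩ := h.exists_piece_of_loop (by linarith) hfc hfinj hends
  have hαQ : ∀ t ∈ Set.Icc a b, α t ∈ Q := fun t ht =>
    hfα t ht.2 ▸ hfQ t ⟨ht.1, by linarith [ht.2]⟩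
  have hPQ : P = Q := by
    by_contra hPQ
    exact hne (h.t1 P hP Q hQ hPQ ⟨hb, hαQ b ⟨hab.le, le_rfl⟩⟩ ⟨ha, hαQ a ⟨le_rfl, hab.le⟩⟩)
  exact hout ((a + b) / 2) ⟨by linarith, by linarith⟩
    (hPQ ▸ hαQ _ ⟨by linarith, by linarith⟩)

/-- Two geodesics issuing from the same point enter a given piece at the same point. -/
lemma IsTreeGraded.entry_point_unique (h : IsTreeGraded X PX) {P : Set X} (hP : P ∈ PX)
    {γ γ' : ℝ → X} {L L' : ℝ} (hL : 0 ≤ L) (hL' : 0 ≤ L') (hγ : IsGeodesicSegment γ 0 L)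
    (hγ' : IsGeodesicSegment γ' 0 L') (h0 : γ 0 = γ' 0) (hγP : γ L ∈ P) (hγP' : γ' L' ∈ P)
    (hout : ∀ t ∈ Set.Ico 0 L, γ t ∉ P) (hout' : ∀ t ∈ Set.Ico 0 L', γ' t ∉ P) :
    γ L = γ' L' := by
  by_contra hne
  have hcommon : IsCompact {t ∈ Set.Icc 0 (min L L') | dist (γ t) (γ' t) = 0} := by
    have hc := continuous_dist.comp_continuousOn
      ((hγ.mono le_rfl (min_le_left L L')).continuousOn.prodMk
        (hγ'.mono le_rfl (min_le_right L L')).continuousOn)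
    exact isCompact_Icc.of_isClosed_subset
      (hc.preimage_isClosed_of_isClosed isClosed_Icc (isClosed_singleton (x := (0 : ℝ))))
      Set.inter_subset_left
  obtain ⟨s, ⟨⟨hs0, hsm⟩, hs⟩, hmax⟩ :=
    hcommon.exists_isGreatest ⟨0, ⟨le_rfl, le_min hL hL'⟩, by rw [h0, dist_self]⟩
  rw [dist_eq_zero] at hs
  have hsL : s ≤ L := hsm.trans (min_le_left _ _)
  have hsL' : s ≤ L' := hsm.trans (min_le_right _ _)
  have hboth : s < L ∧ s < L' := by
    rcases hsL.eq_or_lt with rfl | h1 <;> rcases hsL'.eq_or_lt with rfl | h2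
    · exact absurd hs hne
    · exact absurd (hs ▸ hγP) (hout' s ⟨hs0, h2⟩)
    · exact absurd (hs ▸ hγP') (hout s ⟨hs0, h1⟩)
    · exact ⟨h1, h2⟩
  obtain ⟨hsL, hsL'⟩ := hboth
  let α : ℝ → X := fun t => if t ≤ 0 then γ (s - t) else γ' (s + t)
  have hαγ : ∀ t, t ≤ 0 → α t = γ (s - t) := fun t ht => if_pos ht
  have hαγ' : ∀ t, 0 < t → α t = γ' (s + t) := fun t ht => if_neg ht.not_ge
  have hαc : ContinuousOn α (Set.Icc (s - L) (L' - s)) := by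
    refine continuousOn_ite_le_Icc (by linarith) (by linarith) ?_ ?_ (by simpa using hs)
    · exact hγ.continuousOn.comp (by fun_prop) fun t ht =>
        ⟨by linarith [ht.2], by linarith [ht.1]⟩
    · exact hγ'.continuousOn.comp (by fun_prop) fun t ht =>
        ⟨by linarith [ht.1], by linarith [ht.2]⟩
  have hmixed : ∀ t ∈ Set.Icc (s - L) (L' - s), ∀ u ∈ Set.Icc (s - L) (L' - s),
      t ≤ 0 → 0 < u → α t ≠ α u := by
    intro t ht u hu ht0 hu0 heq
    rw [hαγ t ht0, hαγ' u hu0] at heq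
    have ht' : s - t ∈ Set.Icc 0 L := ⟨by linarith, by linarith [ht.1]⟩
    have hu' : s + u ∈ Set.Icc 0 L' := ⟨by linarith, by linarith [hu.2]⟩
    have htu : s - t = s + u := by
      rw [← hγ.dist_zero_left ht', ← hγ'.dist_zero_left hu', h0, heq]
    rw [htu] at heq ht'
    have := hmax ⟨⟨hu'.1, le_min ht'.2 hu'.2⟩, dist_eq_zero.2 heq⟩
    linarith
  have hαinj : Set.InjOn α (Set.Icc (s - L) (L' - s)) := by
    intro t ht u hu heq
    rcases le_or_gt t 0 with ht0 | ht0 <;> rcases le_or_gt u 0 with hu0 | hu0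
    · rw [hαγ t ht0, hαγ u hu0] at heq
      have := hγ.injOn ⟨by linarith, by linarith [ht.1]⟩ ⟨by linarith, by linarith [hu.1]⟩ heq
      linarith
    · exact absurd heq (hmixed t ht u hu ht0 hu0)
    · exact absurd heq.symm (hmixed u hu t ht hu0 ht0)
    · rw [hαγ' t ht0, hαγ' u hu0] at heq
      have := hγ'.injOn ⟨by linarith, by linarith [ht.2]⟩ ⟨by linarith, by linarith [hu.2]⟩ heq
      linarith
  obtain ⟨t, ht, htP⟩ := h.exists_mem_Ioo_of_arc hP (by linarith) hαc hαinj
    (by rwa [hαγ _ (by linarith), sub_sub_cancel])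
    (by rwa [hαγ' _ (by linarith), add_sub_cancel])
  rcases le_or_gt t 0 with ht0 | ht0
  · exact hout (s - t) ⟨by linarith, by linarith [ht.1]⟩ (hαγ t ht0 ▸ htP)
  · exact hout' (s + t) ⟨by linarith, by linarith [ht.2]⟩ (hαγ' t ht0 ▸ htP)

end TreeGraded

/-- For every point `x` of a tree-graded space and every piece `P`, there is a unique
point `y ∈ P` with `d(x, P) = d(x, y)`; moreover every geodesic joining `x` with a
point of `P` contains `y`. -/
theorem exists_unique_projection (X : Type*) [MetricSpace X] [CompleteSpace X]
    (PX : Set (Set X)) (hgeo : GeodesicSpace X) (hTG : IsTreeGraded X PX)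
    (P : Set X) (hP : P ∈ PX) (x : X) :
    ∃ y ∈ P, dist x y = Metric.infDist x P ∧
      (∀ y' ∈ P, dist x y' = Metric.infDist x P → y' = y) ∧
      ∀ p ∈ P, ∀ (γ : ℝ → X) (L : ℝ), 0 ≤ L → IsGeodesicSegment γ 0 L →
        γ 0 = x → γ L = p → ∃ t ∈ Set.Icc (0 : ℝ) L, γ t = y := by
  obtain ⟨p₀, hp₀⟩ := hTG.nonempty P hP
  obtain ⟨γ₀, hγ₀, hγ₀x, hγ₀p⟩ := hgeo x p₀
  obtain ⟨t₀, ht₀, ht₀P, hfirst₀⟩ :=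
    hγ₀.exists_first_mem dist_nonneg (hTG.closed P hP) (by rwa [hγ₀p])
  have hthrough : ∀ p ∈ P, ∀ (γ : ℝ → X) (L : ℝ), 0 ≤ L → IsGeodesicSegment γ 0 L →
      γ 0 = x → γ L = p → ∃ t ∈ Set.Icc (0 : ℝ) L, γ t = γ₀ t₀ := by
    intro p hp γ L hL hγ hγx hγp
    obtain ⟨t, ht, htP, hfirst⟩ := hγ.exists_first_mem hL (hTG.closed P hP) (hγp ▸ hp)
    exact ⟨t, ht, hTG.entry_point_unique hP ht.1 ht₀.1 (hγ.mono le_rfl ht.2)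
      (hγ₀.mono le_rfl ht₀.2) (hγx.trans hγ₀x.symm) htP ht₀P hfirst hfirst₀⟩
  have hnear : ∀ p ∈ P, dist x (γ₀ t₀) ≤ dist x p ∧
      (dist x p = dist x (γ₀ t₀) → p = γ₀ t₀) := by
    intro p hp
    obtain ⟨γ, hγ, hγx, hγp⟩ := hgeo x p
    obtain ⟨t, ht, hty⟩ := hthrough p hp γ _ dist_nonneg hγ hγx hγp
    have hd : dist x (γ₀ t₀) = t := by rw [← hγ.dist_zero_left ht, hγx, hty]
    exact ⟨hd.trans_le ht.2, fun he => by rw [← hγp, ← hty, he, hd]⟩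
  have hdist : dist x (γ₀ t₀) = Metric.infDist x P :=
    le_antisymm ((Metric.le_infDist ⟨p₀, hp₀⟩).2 fun {p} hp => (hnear p hp).1)
      (Metric.infDist_le_dist_of_mem ht₀P)
  exact ⟨γ₀ t₀, ht₀P, hdist, fun p hp he => (hnear p hp).2 (he.trans hdist.symm), hthrough⟩
end
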